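/- For all n ≥ 1 and all j ≥ 0, the number a_{n,j}^{(2)} of 231-avoiding permutations σ of {1,…,n} with des(σ) = j and md(σ) ≤ 2 equals Σ_{i=0}^{j} C(j, 2i) · C(n+i, 2j). -/

import Mathlib

/-- σ avoids the pattern 231: no indices i < j < k with σ k < σ i < σ j. -/
def avoids231 {n : ℕ} (σ : Equiv.Perm (Fin n)) : Prop :=
  ¬ ∃ i j k : Fin n, i < j ∧ j < k ∧ σ k < σ i ∧ σ i < σ j

/-- The number of descents of σ : positions i with σ i > σ (i+1). -/
noncomputable def des {n : ℕ} (σ : Equiv.Perm (Fin n)) : ℕ :=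
  Nat.card {i : Fin n // ∃ h : (i : ℕ) + 1 < n, σ ⟨(i : ℕ) + 1, h⟩ < σ i}

/-- The maximum drop of σ : the maximum of i - σ i. -/
def maxDrop {n : ℕ} (σ : Equiv.Perm (Fin n)) : ℕ :=
  Finset.univ.sup fun i : Fin n => (i : ℕ) - (σ i : ℕ)

/-- a n j k : the number of 231-avoiding permutations of {1,…,n} with
j descents and maximum drop at most k. -/
noncomputable def a (n j k : ℕ) : ℕ :=
  Nat.card {σ : Equiv.Perm (Fin n) // avoids231 σ ∧ des σ = j ∧ maxDrop σ ≤ k}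

open Polynomial in
/-- The descent polynomial of the 231-avoiding permutations of `Fin n` with maximum drop at most
`k`. -/
noncomputable def desPoly (n k : ℕ) : ℤ[X] :=
  open Classical in
  ∑ σ : Equiv.Perm (Fin n) with avoids231 σ ∧ maxDrop σ ≤ k, (X : ℤ[X]) ^ des σ

open Polynomial in
theorem coeff_desPoly (n j k : ℕ) : (desPoly n k).coeff j = a n j k := by
  classical
  simp only [desPoly, finsetSum_coeff, coeff_X_pow, a, Nat.card_eq_fintype_card,
    Fintype.card_subtype, Finset.sum_boole, Finset.filter_filter]
  norm_cast
  congr 1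
  ext σ
  simp only [Finset.mem_filter, Finset.mem_univ, true_and]
  grind

theorem maxDrop_le_iff {n k : ℕ} (σ : Equiv.Perm (Fin n)) :
    maxDrop σ ≤ k ↔ ∀ i : Fin n, (i : ℕ) ≤ σ i + k := by
  simp only [maxDrop, Finset.sup_le_iff, Finset.mem_univ, true_imp_iff]
  exact forall_congr' fun i => by omega

open Classical in
theorem des_eq_sum {n : ℕ} (σ : Equiv.Perm (Fin n)) :
    des σ = ∑ i : Fin n, if ∀ i' : Fin n, (i' : ℕ) = i + 1 → σ i ≤ σ i' then 0 else 1 := by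
  rw [des, Nat.card_eq_fintype_card, Fintype.card_subtype, Finset.card_filter]
  refine Finset.sum_congr rfl fun i _ => ?_
  rw [← ite_not]
  refine if_congr ?_ rfl rfl
  push Not
  exact ⟨fun h i' hi' => (h (by omega)).trans_eq (congrArg σ (Fin.ext hi'.symm)),
    fun h h' => h ⟨_, h'⟩ rfl⟩

/-- Place `τ` before the maximum and a shifted copy of `ρ` after it. -/
def glue {m r : ℕ} (τ : Equiv.Perm (Fin m)) (ρ : Equiv.Perm (Fin r)) :
    Equiv.Perm (Fin (m + (r + 1))) :=
  finSumFinEquiv.permCongr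
    (τ.sumCongr ((finRotate (r + 1)).symm * Equiv.Perm.decomposeFin.symm (0, ρ)))

section glue

variable {m r : ℕ} (τ : Equiv.Perm (Fin m)) (ρ : Equiv.Perm (Fin r))

@[simp]
theorem glue_castAdd (i : Fin m) :
    glue τ ρ (Fin.castAdd (r + 1) i) = Fin.castAdd (r + 1) (τ i) := by
  simp [glue, Equiv.permCongr_apply]

@[simp]
theorem glue_natAdd_zero : glue τ ρ (Fin.natAdd m 0) = Fin.natAdd m (Fin.last r) := by
  have : (-1 : Fin (r + 1)) = Fin.last r := by ext; simp [Fin.coe_neg_one]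
  simp [glue, Equiv.permCongr_apply, this]

@[simp]
theorem glue_natAdd_succ (i : Fin r) :
    glue τ ρ (Fin.natAdd m i.succ) = Fin.natAdd m (ρ i).castSucc := by
  simp [glue, Equiv.permCongr_apply, sub_eq_iff_eq_add]

theorem forall_fin_add_succ {p : Fin (m + (r + 1)) → Prop} :
    (∀ i, p i) ↔ (∀ i : Fin m, p (Fin.castAdd (r + 1) i)) ∧ p (Fin.natAdd m 0) ∧
      ∀ i : Fin r, p (Fin.natAdd m i.succ) := by
  refine ⟨fun h => ⟨fun i => h _, h _, fun i => h _⟩, fun h i => ?_⟩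
  induction i using Fin.addCases with
  | left i => exact h.1 i
  | right i =>
    induction i using Fin.cases with
    | zero => exact h.2.1
    | succ i => exact h.2.2 i

theorem maxDrop_glue_le_iff {k : ℕ} :
    maxDrop (glue τ ρ) ≤ k + 1 ↔ maxDrop τ ≤ k + 1 ∧ maxDrop ρ ≤ k := by
  simp only [maxDrop_le_iff, forall_fin_add_succ, glue_castAdd, glue_natAdd_zero,
    glue_natAdd_succ, Fin.val_castAdd, Fin.val_natAdd, Fin.val_succ, Fin.val_castSucc,
    Fin.val_last, Fin.val_zero]
  refine and_congr_right fun _ => ⟨fun h i => ?_, fun h => ⟨by omega, fun i => ?_⟩⟩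
  · have := h.2 i
    omega
  · have := h i
    omega

theorem avoids231_glue_iff : avoids231 (glue τ ρ) ↔ avoids231 τ ∧ avoids231 ρ := by
  simp only [avoids231, not_exists]
  constructor
  · refine fun h => ⟨fun i j k hijk => ?_, fun i j k hijk => ?_⟩
    · apply h (Fin.castAdd _ i) (Fin.castAdd _ j) (Fin.castAdd _ k)
      simp only [Fin.lt_def, glue_castAdd, Fin.val_castAdd] at hijk ⊢
      omega
    · apply h (Fin.natAdd m i.succ) (Fin.natAdd m j.succ) (Fin.natAdd m k.succ)
      simp only [Fin.lt_def, glue_natAdd_succ, Fin.val_natAdd, Fin.val_succ, Fin.val_castSucc]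
        at hijk ⊢
      omega
  · rintro ⟨hτ, hρ⟩
    simp only [forall_fin_add_succ, glue_castAdd, glue_natAdd_zero, glue_natAdd_succ, Fin.lt_def,
      Fin.val_castAdd, Fin.val_natAdd, Fin.val_succ, Fin.val_castSucc, Fin.val_last, Fin.val_zero]
      at hτ hρ ⊢
    refine ⟨fun i => ⟨fun j => ⟨hτ i j, ?_, ?_⟩, ⟨?_, ?_, ?_⟩, fun j => ⟨?_, ?_, ?_⟩⟩,
      ⟨fun j => ⟨?_, ?_, ?_⟩, ⟨?_, ?_, ?_⟩, fun j => ⟨?_, ?_, ?_⟩⟩,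
      fun i => ⟨fun j => ⟨?_, ?_, ?_⟩, ⟨?_, ?_, ?_⟩, fun j => ⟨?_, ?_, fun k => ?_⟩⟩⟩
    on_goal 26 =>
      have := hρ i j k
      omega
    all_goals omega

theorem des_glue : des (glue τ ρ) = des τ + ((if r = 0 then 0 else 1) + des ρ) := by
  classical
  simp only [des_eq_sum, Fin.sum_univ_add, Fin.sum_univ_succ (n := r), forall_fin_add_succ,
    glue_castAdd, glue_natAdd_zero, glue_natAdd_succ, Fin.le_def, Fin.val_castAdd,
    Fin.val_natAdd, Fin.val_succ, Fin.val_castSucc, Fin.val_last, Fin.val_zero]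
  congr 1
  · refine Finset.sum_congr rfl fun i _ => if_congr ?_ rfl rfl
    exact ⟨fun h => h.1, fun h => ⟨h, by omega, by omega⟩⟩
  · congr 1
    · refine if_congr ⟨fun h => ?_, fun h => ⟨by omega, by omega, by omega⟩⟩ rfl rfl
      by_contra hr
      have := h.2.2 ⟨0, by omega⟩ (by simp)
      omega
    · refine Finset.sum_congr rfl fun i _ => if_congr ?_ rfl rfl
      refine ⟨fun h i' hi' => ?_, fun h => ⟨by omega, by omega, fun i' hi' => ?_⟩⟩
      · have := h.2.2 i' (by omega)
        omega
      · have := h i' (by omega)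
        omega

theorem glue_injective {τ' : Equiv.Perm (Fin m)} {ρ' : Equiv.Perm (Fin r)}
    (h : glue τ ρ = glue τ' ρ') : τ = τ' ∧ ρ = ρ' := by
  constructor
  · ext i
    have := congrArg Fin.val (DFunLike.congr_fun h (Fin.castAdd _ i))
    simpa using this
  · ext i
    have := congrArg Fin.val (DFunLike.congr_fun h (Fin.natAdd m i.succ))
    simpa using this

end glue

theorem exists_glue_eq {m r : ℕ} (σ : Equiv.Perm (Fin (m + (r + 1)))) (hσ : avoids231 σ)
    (hm : σ (Fin.natAdd m 0) = Fin.natAdd m (Fin.last r)) : ∃ τ ρ, glue τ ρ = σ := by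
  have lt_of_lt (i : Fin m) (k : Fin r) :
      σ (Fin.castAdd (r + 1) i) < σ (Fin.natAdd m k.succ) := by
    by_contra! h
    have h1 : σ (Fin.natAdd m k.succ) ≠ σ (Fin.castAdd (r + 1) i) := by
      simp [Fin.ext_iff]
      omega
    have h2 : σ (Fin.castAdd (r + 1) i) ≠ σ (Fin.natAdd m 0) := by
      simp [Fin.ext_iff]
      omega
    refine hσ ⟨Fin.castAdd (r + 1) i, Fin.natAdd m 0, Fin.natAdd m k.succ, ?_, ?_,
      lt_of_le_of_ne h h1, lt_of_le_of_ne ?_ h2⟩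
    · simp [Fin.lt_def]
    · simp [Fin.lt_def]
    · rw [hm, Fin.le_def]
      simp
      omega
  have left_lt (i : Fin m) : (σ (Fin.castAdd (r + 1) i) : ℕ) < m := by
    have := Finset.card_le_card_of_injOn (s := (Finset.univ : Finset (Fin (r + 1))))
      (t := Finset.Ioi (σ (Fin.castAdd (r + 1) i))) (fun k => σ (Fin.natAdd m k))
      (fun k _ => by
        simp only [Finset.coe_Ioi, Set.mem_Ioi]
        induction k using Fin.cases with
        | zero =>
          refine lt_of_le_of_ne ?_ (by simp [Fin.ext_iff]; omega)
          rw [hm, Fin.le_def]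
          simp
          omega
        | succ k => exact lt_of_lt i k)
      (fun k _ l _ h => by simpa using h)
    simp at this
    omega
  have right_ge (k : Fin r) : m ≤ (σ (Fin.natAdd m k.succ) : ℕ) := by
    have := Finset.card_le_card_of_injOn (s := (Finset.univ : Finset (Fin m)))
      (t := Finset.Iio (σ (Fin.natAdd m k.succ))) (fun i => σ (Fin.castAdd (r + 1) i))
      (fun i _ => by simpa using lt_of_lt i k)
      (fun k _ l _ h => by simpa using h)
    simpa using this
  have right_lt (k : Fin r) : (σ (Fin.natAdd m k.succ) : ℕ) - m < r := by
    have : σ (Fin.natAdd m k.succ) ≠ σ (Fin.natAdd m 0) := by simp [Fin.ext_iff]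
    rw [hm, Ne, Fin.ext_iff, Fin.val_natAdd, Fin.val_last] at this
    have := k.isLt
    omega
  let τ : Fin m → Fin m := fun i => ⟨σ (Fin.castAdd (r + 1) i), left_lt i⟩
  let ρ : Fin r → Fin r := fun k => ⟨σ (Fin.natAdd m k.succ) - m, right_lt k⟩
  have hτ : Function.Injective τ := fun i j h => by simpa [τ, ← Fin.ext_iff] using h
  have hρ : Function.Injective ρ := fun i j h => by
    have h1 := right_ge i
    have h2 := right_ge j
    have h3 : (σ (Fin.natAdd m i.succ) : ℕ) = σ (Fin.natAdd m j.succ) := by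
      simp only [ρ, Fin.mk.injEq] at h
      omega
    simpa [← Fin.ext_iff] using h3
  refine ⟨Equiv.ofBijective τ (Finite.injective_iff_bijective.1 hτ),
    Equiv.ofBijective ρ (Finite.injective_iff_bijective.1 hρ), ?_⟩
  refine Equiv.ext (forall_fin_add_succ.2 ⟨fun i => ?_, ?_, fun k => ?_⟩)
  · ext
    simp [τ]
  · rw [hm, glue_natAdd_zero]
  · have := right_ge k
    ext
    simp [ρ]
    omega

section desPoly

open Polynomial

open Classical in
theorem sum_fiber_eq {n m r : ℕ} (h : n = m + r) (k : ℕ) :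
    ∑ σ : Equiv.Perm (Fin (n + 1)) with
      (avoids231 σ ∧ maxDrop σ ≤ k + 1) ∧ (σ.symm (Fin.last n) : ℕ) = m, (X : ℤ[X]) ^ des σ =
    desPoly m (k + 1) * (if r = 0 then 1 else X * desPoly r k) := by
  subst h
  have hr : (if r = 0 then 1 else X * desPoly r k) =
      (X : ℤ[X]) ^ (if r = 0 then 0 else 1) * desPoly r k := by
    split_ifs with h
    · subst h
      have : ∀ σ : Equiv.Perm (Fin 0), avoids231 σ ∧ maxDrop σ ≤ k :=
        fun σ => ⟨fun ⟨i, _⟩ => i.elim0, by simp [maxDrop]⟩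
      simp [desPoly, this, des]
    · simp
  rw [hr, desPoly, desPoly, Finset.mul_sum, Finset.sum_mul_sum, ← Finset.sum_product']
  symm
  refine Finset.sum_bij (fun p _ => glue (m := m) (r := r) p.1 p.2) ?_ ?_ ?_ ?_
  · rintro ⟨τ, ρ⟩ h
    simp only [Finset.mem_product, Finset.mem_filter, Finset.mem_univ, true_and] at h ⊢
    refine ⟨⟨(avoids231_glue_iff τ ρ).2 ⟨h.1.1, h.2.1⟩,
      (maxDrop_glue_le_iff τ ρ).2 ⟨h.1.2, h.2.2⟩⟩, ?_⟩
    change ((glue τ ρ).symm (Fin.natAdd m (Fin.last r)) : ℕ) = m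
    rw [(Equiv.symm_apply_eq _).2 (glue_natAdd_zero τ ρ).symm]
    simp
  · rintro ⟨τ, ρ⟩ - ⟨τ', ρ'⟩ - h
    exact Prod.ext_iff.2 (glue_injective τ ρ h)
  · intro σ h
    simp only [Finset.mem_filter, Finset.mem_univ, true_and] at h
    have hm : σ (Fin.natAdd m (0 : Fin (r + 1))) = Fin.natAdd m (Fin.last r) := by
      have : σ.symm (Fin.last (m + r)) = Fin.natAdd m (0 : Fin (r + 1)) := Fin.ext h.2
      rw [← this, Equiv.apply_symm_apply]
      rfl
    obtain ⟨τ, ρ, rfl⟩ := exists_glue_eq (m := m) (r := r) σ h.1.1 hm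
    have h1 := (avoids231_glue_iff τ ρ).1 h.1.1
    have h2 := (maxDrop_glue_le_iff τ ρ).1 h.1.2
    exact ⟨(τ, ρ), by simp [h1, h2], rfl⟩
  · rintro ⟨τ, ρ⟩ -
    simp only
    rw [des_glue, pow_add, pow_add]

theorem desPoly_succ (n k : ℕ) :
    desPoly (n + 1) (k + 1) = ∑ p ∈ Finset.HasAntidiagonal.antidiagonal n,
      desPoly p.1 (k + 1) * (if p.2 = 0 then 1 else X * desPoly p.2 k) := by
  classical
  rw [Finset.Nat.sum_antidiagonal_eq_sum_range_succ_mk, desPoly,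
    ← Finset.sum_fiberwise_of_maps_to (t := Finset.range n.succ)
      (g := fun σ : Equiv.Perm (Fin (n + 1)) => (σ.symm (Fin.last n) : ℕ))
      (fun σ _ => Finset.mem_range.2 (Fin.isLt _))]
  refine Finset.sum_congr rfl fun m hm => ?_
  rw [Finset.filter_filter]
  exact sum_fiber_eq (by simp at hm; omega) k

theorem desPoly_zero_left (k : ℕ) : desPoly 0 k = 1 := by
  have : ∀ σ : Equiv.Perm (Fin 0), avoids231 σ ∧ maxDrop σ ≤ k :=
    fun σ => ⟨fun ⟨i, _⟩ => i.elim0, by simp [maxDrop]⟩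
  simp [desPoly, this, des]

theorem desPoly_zero_right (n : ℕ) : desPoly n 0 = 1 := by
  classical
  have : ∀ σ : Equiv.Perm (Fin n), avoids231 σ ∧ maxDrop σ ≤ 0 ↔ σ = 1 := by
    refine fun σ => ⟨fun ⟨_, h⟩ => ?_, ?_⟩
    · rw [maxDrop_le_iff] at h
      have h1 := (Finset.sum_eq_sum_iff_of_le (s := Finset.univ) (fun i _ => h i)).1
        (Equiv.sum_comp σ (fun i : Fin n => (i : ℕ))).symm
      ext i
      simpa using (h1 i (Finset.mem_univ i)).symm
    · rintro rfl
      refine ⟨?_, by simp [maxDrop]⟩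
      rintro ⟨i, j, k, hij, hjk, hki, -⟩
      exact absurd (hij.trans hjk) hki.asymm
  have hd : des (1 : Equiv.Perm (Fin n)) = 0 := by
    simp [des, Fin.lt_def]
  simp only [desPoly, this, Finset.filter_eq', Finset.mem_univ, if_true, Finset.sum_singleton, hd,
    pow_zero]

/-- The generating function of the descent polynomials `desPoly n k`. -/
noncomputable def desSeries (k : ℕ) : PowerSeries ℤ[X] :=
  PowerSeries.mk fun n => desPoly n k

theorem desSeries_zero : (1 - PowerSeries.X) * desSeries 0 = 1 := by
  have : desSeries 0 = PowerSeries.mk 1 := by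
    ext1 n
    simp [desSeries, desPoly_zero_right]
  rw [this, mul_comm, PowerSeries.mk_one_mul_one_sub_eq_one]

theorem desSeries_succ (k : ℕ) : desSeries (k + 1) =
    1 + PowerSeries.X * (desSeries (k + 1) * (1 + PowerSeries.C X * (desSeries k - 1))) := by
  have h : 1 + PowerSeries.C X * (desSeries k - 1) =
      PowerSeries.mk fun n => if n = 0 then 1 else X * desPoly n k := by
    ext1 n
    rcases n with _ | n
    · simp [desSeries, desPoly_zero_left]
    · simp [desSeries, PowerSeries.coeff_one]
  rw [h]
  ext1 n
  rcases n with _ | n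
  · simp [desSeries, desPoly_zero_left]
  · rw [map_add, PowerSeries.coeff_succ_X_mul]
    simp [desSeries, PowerSeries.coeff_one, PowerSeries.coeff_mul, desPoly_succ]

theorem desSeries_one :
    ((1 - PowerSeries.X) ^ 2 - PowerSeries.C X * PowerSeries.X ^ 2) * desSeries 1 =
      1 - PowerSeries.X := by
  have h0 := desSeries_zero
  have h1 := desSeries_succ 0
  rw [zero_add] at h1
  linear_combination (1 - PowerSeries.X) * h1 +
    PowerSeries.X * PowerSeries.C X * desSeries 1 * h0

theorem desSeries_two :
    ((1 - PowerSeries.X) ^ 3 - PowerSeries.C X * (2 * PowerSeries.X ^ 2 * (1 - PowerSeries.X)) -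
      PowerSeries.C X * (PowerSeries.C X * PowerSeries.X ^ 3)) * desSeries 2 =
      (1 - PowerSeries.X) ^ 2 - PowerSeries.C X * PowerSeries.X ^ 2 := by
  have h1 := desSeries_one
  have h2 := desSeries_succ 1
  rw [one_add_one_eq_two] at h2
  linear_combination ((1 - PowerSeries.X) ^ 2 - PowerSeries.C X * PowerSeries.X ^ 2) * h2 +
    PowerSeries.X * PowerSeries.C X * desSeries 2 * h1

/-- The power series formed by the `j`-th coefficients of the coefficients of `f`. -/
noncomputable def coeffSeries (j : ℕ) : PowerSeries ℤ[X] →+ PowerSeries ℤ where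
  toFun f := PowerSeries.mk fun n => (PowerSeries.coeff n f).coeff j
  map_zero' := by ext; simp
  map_add' f g := by ext; simp

theorem coeff_coeffSeries (j n : ℕ) (f : PowerSeries ℤ[X]) :
    PowerSeries.coeff n (coeffSeries j f) = (PowerSeries.coeff n f).coeff j := by
  simp [coeffSeries]

theorem coeffSeries_map_mul (j : ℕ) (p : PowerSeries ℤ) (f : PowerSeries ℤ[X]) :
    coeffSeries j (PowerSeries.map C p * f) = p * coeffSeries j f := by
  ext n
  simp [coeff_coeffSeries, PowerSeries.coeff_mul, Polynomial.finsetSum_coeff]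

theorem coeffSeries_succ_C_X_mul (j : ℕ) (f : PowerSeries ℤ[X]) :
    coeffSeries (j + 1) (PowerSeries.C X * f) = coeffSeries j f := by
  ext n
  simp [coeff_coeffSeries]

theorem coeffSeries_zero_C_X_mul (f : PowerSeries ℤ[X]) :
    coeffSeries 0 (PowerSeries.C X * f) = 0 := by
  ext n
  simp [coeff_coeffSeries]

theorem coeffSeries_zero_map (p : PowerSeries ℤ) : coeffSeries 0 (PowerSeries.map C p) = p := by
  ext n
  simp [coeff_coeffSeries]

theorem coeffSeries_succ_map (j : ℕ) (p : PowerSeries ℤ) :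
    coeffSeries (j + 1) (PowerSeries.map C p) = 0 := by
  ext n
  rw [coeff_coeffSeries, PowerSeries.coeff_map, coeff_C_succ, map_zero]

theorem map_desSeries_two :
    PowerSeries.map C ((1 - PowerSeries.X) ^ 3) * desSeries 2 =
      PowerSeries.C X * (PowerSeries.map C (2 * PowerSeries.X ^ 2 * (1 - PowerSeries.X)) *
        desSeries 2) +
      PowerSeries.C X * (PowerSeries.C X * (PowerSeries.map C (PowerSeries.X ^ 3) * desSeries 2)) +
      PowerSeries.map C ((1 - PowerSeries.X) ^ 2) -
      PowerSeries.C X * PowerSeries.map C (PowerSeries.X ^ 2) := by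
  simp only [map_pow, map_sub, map_mul, map_one, PowerSeries.map_X, map_ofNat]
  linear_combination desSeries_two

end desPoly

open PowerSeries in
theorem coeffSeries_zero_desSeries_two :
    (1 - X : ℤ⟦X⟧) ^ 3 * coeffSeries 0 (desSeries 2) = (1 - X) ^ 2 := by
  have h := congrArg (coeffSeries 0) map_desSeries_two
  simpa only [map_add, map_sub (coeffSeries _), coeffSeries_map_mul, coeffSeries_zero_C_X_mul,
    coeffSeries_zero_map, zero_add, sub_zero] using h

open PowerSeries in
theorem coeffSeries_one_desSeries_two :
    (1 - X : ℤ⟦X⟧) ^ 3 * coeffSeries 1 (desSeries 2) =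
      2 * X ^ 2 * (1 - X) * coeffSeries 0 (desSeries 2) - X ^ 2 := by
  have h := congrArg (coeffSeries (0 + 1)) map_desSeries_two
  simpa only [map_add, map_sub (coeffSeries _), coeffSeries_map_mul, coeffSeries_zero_C_X_mul,
    coeffSeries_succ_C_X_mul, coeffSeries_succ_map, coeffSeries_zero_map, zero_add, add_zero]
    using h

open PowerSeries in
theorem coeffSeries_add_two_desSeries_two (j : ℕ) :
    (1 - X : ℤ⟦X⟧) ^ 3 * coeffSeries (j + 2) (desSeries 2) =
      2 * X ^ 2 * (1 - X) * coeffSeries (j + 1) (desSeries 2) +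
        X ^ 3 * coeffSeries j (desSeries 2) := by
  have h := congrArg (coeffSeries (j + 1 + 1)) map_desSeries_two
  simpa only [map_add, map_sub (coeffSeries _), coeffSeries_map_mul, coeffSeries_succ_C_X_mul,
    coeffSeries_succ_map, add_zero, sub_zero] using h

section chooseSum

variable {R : Type*} [CommRing R]

/-- The even part `∑ i, C(j, 2i) x^(2j - i)` of `(x² + x y)ʲ`, where `y² = x`. -/
def evenChooseSum (x : R) (j : ℕ) : R :=
  ∑ i ∈ Finset.range (j + 1), (j.choose (2 * i) : R) * x ^ (2 * j - i)

/-- The odd part of `(x² + x y)ʲ`, where `y² = x`, multiplied by `y`. -/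
def oddChooseSum (x : R) (j : ℕ) : R :=
  ∑ i ∈ Finset.range (j + 1), (j.choose (2 * i + 1) : R) * x ^ (2 * j - i)

theorem evenChooseSum_succ (x : R) (j : ℕ) :
    evenChooseSum x (j + 1) = x ^ 2 * evenChooseSum x j + x * oddChooseSum x j := by
  have h : evenChooseSum x j =
      ∑ i ∈ Finset.range (j + 1 + 1), (j.choose (2 * i) : R) * x ^ (2 * j - i) := by
    rw [Finset.sum_range_succ, Nat.choose_eq_zero_of_lt (by omega)]
    simp [evenChooseSum]
  rw [h, Finset.sum_range_succ', evenChooseSum, Finset.sum_range_succ', oddChooseSum, mul_add (x ^ 2),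
    Finset.mul_sum, Finset.mul_sum, add_right_comm, ← Finset.sum_add_distrib]
  congr 1
  · refine Finset.sum_congr rfl fun i hi => ?_
    rw [Finset.mem_range] at hi
    rw [show 2 * (i + 1) = 2 * i + 1 + 1 by ring, Nat.choose_succ_succ]
    rcases Nat.lt_or_ge j (2 * i + 1) with hj | hj
    · rw [Nat.choose_eq_zero_of_lt hj, Nat.choose_eq_zero_of_lt (hj.trans (Nat.lt_succ_self _))]
      simp
    · rw [show 2 * (j + 1) - (i + 1) = (2 * j - (i + 1)) + 2 by omega,
        show 2 * j - i = (2 * j - (i + 1)) + 1 by omega]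
      push_cast
      ring
  · simp
    ring

theorem oddChooseSum_succ (x : R) (j : ℕ) :
    oddChooseSum x (j + 1) = x ^ 2 * evenChooseSum x j + x ^ 2 * oddChooseSum x j := by
  rw [oddChooseSum, Finset.sum_range_succ, Nat.choose_eq_zero_of_lt (by omega), ← mul_add,
    evenChooseSum, oddChooseSum, ← Finset.sum_add_distrib, Finset.mul_sum]
  simp only [Nat.cast_zero, zero_mul, add_zero]
  refine Finset.sum_congr rfl fun i hi => ?_
  rw [Finset.mem_range] at hi
  rw [Nat.choose_succ_succ, show 2 * (j + 1) - i = (2 * j - i) + 2 by omega]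
  push_cast
  ring

theorem evenChooseSum_add_two (x : R) (j : ℕ) :
    evenChooseSum x (j + 2) =
      2 * x ^ 2 * evenChooseSum x (j + 1) + (1 - x) * x ^ 3 * evenChooseSum x j := by
  rw [evenChooseSum_succ x (j + 1), oddChooseSum_succ]
  linear_combination -x ^ 2 * evenChooseSum_succ x j

end chooseSum

open PowerSeries in
theorem one_sub_pow_mul_coeffSeries (j : ℕ) :
    (1 - X : ℤ⟦X⟧) ^ (2 * j + 1) * coeffSeries j (desSeries 2) = evenChooseSum X j := by
  have hX : (1 - X : ℤ⟦X⟧) ≠ 0 := fun h => by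
    simpa using congrArg constantCoeff h
  have h0 : (1 - X : ℤ⟦X⟧) * coeffSeries 0 (desSeries 2) = 1 := by
    refine mul_left_cancel₀ (pow_ne_zero 2 hX) ?_
    linear_combination coeffSeries_zero_desSeries_two
  induction j using Nat.twoStepInduction with
  | zero => simpa [evenChooseSum] using h0
  | one =>
    have : evenChooseSum (X : ℤ⟦X⟧) 1 = X ^ 2 := by simp [evenChooseSum, Finset.sum_range_succ]
    rw [this]
    linear_combination coeffSeries_one_desSeries_two + 2 * X ^ 2 * h0
  | more j ih1 ih2 =>
    rw [evenChooseSum_add_two, ← ih1, ← ih2]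
    linear_combination (1 - X) ^ (2 * j + 2) * coeffSeries_add_two_desSeries_two j

theorem a_two_closed (n j : ℕ) (hn : 1 ≤ n) :
    a n j 2 = ∑ i ∈ Finset.range (j + 1), j.choose (2 * i) * (n + i).choose (2 * j) := by
  have h : coeffSeries j (desSeries 2) =
      evenChooseSum PowerSeries.X j * (PowerSeries.invOneSubPow ℤ (2 * j + 1)).val := by
    rw [← one_sub_pow_mul_coeffSeries, ← PowerSeries.invOneSubPow_inv_eq_one_sub_pow,
      mul_right_comm, Units.inv_val, one_mul]
  have h' := congrArg (PowerSeries.coeff n) h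
  rw [coeff_coeffSeries, desSeries, PowerSeries.coeff_mk, coeff_desPoly, evenChooseSum,
    Finset.sum_mul, map_sum] at h'
  zify
  rw [h']
  refine Finset.sum_congr rfl fun i hi => ?_
  rw [Finset.mem_range] at hi
  rw [mul_assoc, ← map_natCast (PowerSeries.C (R := ℤ)), PowerSeries.coeff_C_mul,
    PowerSeries.coeff_X_pow_mul', PowerSeries.invOneSubPow_val_succ_eq_mk_add_choose,
    PowerSeries.coeff_mk]
  congr 1
  split_ifs with hle
  · rw [show 2 * j + (n - (2 * j - i)) = n + i by omega]
  · rw [Nat.choose_eq_zero_of_lt (by omega), Nat.cast_zero]
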